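/- Let C be a small, locally finite category. Then C is confluent and has the Ramsey property if and only if for every precompact expansion π : E ⥤ C there exists a functor α : C ⥤ E with π ∘ α = 𝟭_C (the identity functor on C). -/

import Mathlib

open CategoryTheory Opposite

universe v u v' u'

/-- A category is confluent if any two objects connected by a zigzag admit a cocone. -/
def Confluent (C : Type u) [Category.{v} C] : Prop :=
  ∀ A B : C, Zigzag A B → ∃ (Z : C) (_ : A ⟶ Z) (_ : B ⟶ Z), True

/-- The Ramsey property of a category. -/
def RamseyProp (C : Type u) [Category.{v} C] : Prop :=
  ∀ (A B : C) (N : Type) (_ : Finite N), ∃ Z : C,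
    ∀ χ : (A ⟶ Z) → N, ∃ g : B ⟶ Z,
      ∀ f f' : A ⟶ B, χ (f ≫ g) = χ (f' ≫ g)

/-- An (abstract) expansion: a functor that is surjective on objects and a
discrete fibration. -/
structure IsExpansion {E : Type u} {C : Type u'} [Category.{v} E] [Category.{v'} C]
    (π : E ⥤ C) : Prop where
  surj : ∀ c : C, ∃ e : E, π.obj e = c
  fib : ∀ (e : E) (c : C) (f : c ⟶ π.obj e),
    ∃! p : Σ e' : E, e' ⟶ e, ∃ h : π.obj p.1 = c, π.map p.2 = eqToHom h ≫ f

/-- An expansion is precompact if all of its fibers on objects are finite. -/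
def Precompact {E : Type u} {C : Type u'} [Category.{v} E] [Category.{v'} C]
    (π : E ⥤ C) : Prop :=
  ∀ c : C, {e : E | π.obj e = c}.Finite

namespace IsExpansion

variable {E : Type u} {C : Type u'} [Category.{v} E] [Category.{v'} C] {π : E ⥤ C}

theorem exists_lift (hπ : IsExpansion π) {e : E} {c : C} (f : c ⟶ π.obj e) :
    ∃ (e' : E) (h : π.obj e' = c) (g : e' ⟶ e), π.map g = eqToHom h ≫ f := by
  obtain ⟨⟨e', g⟩, ⟨h, hg⟩, -⟩ := hπ.fib e c f
  exact ⟨e', h, g, hg⟩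

theorem lift_unique (hπ : IsExpansion π) {e₁ e₂ e : E} (g₁ : e₁ ⟶ e) (g₂ : e₂ ⟶ e)
    (h : π.obj e₁ = π.obj e₂) (hg : π.map g₁ = eqToHom h ≫ π.map g₂) :
    (⟨e₁, g₁⟩ : Σ e' : E, e' ⟶ e) = ⟨e₂, g₂⟩ :=
  (hπ.fib e _ (π.map g₂)).unique ⟨h, hg⟩ ⟨rfl, by simp⟩

theorem source_eq (hπ : IsExpansion π) {e₁ e₂ e : E} (g₁ : e₁ ⟶ e) (g₂ : e₂ ⟶ e)
    (h : π.obj e₁ = π.obj e₂) (hg : π.map g₁ = eqToHom h ≫ π.map g₂) : e₁ = e₂ :=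
  congrArg Sigma.fst (hπ.lift_unique g₁ g₂ h hg)

theorem faithful (hπ : IsExpansion π) : π.Faithful where
  map_injective {_ _ g₁ g₂} hg :=
    eq_of_heq (Sigma.mk.inj (hπ.lift_unique g₁ g₂ rfl (by simpa using hg))).2

/-- The domain of the lift of `f` along an expansion, as an element of the fiber. -/
noncomputable def pull (hπ : IsExpansion π) {c d : C} (f : c ⟶ d) (e : {e : E // π.obj e = d}) :
    {e : E // π.obj e = c} :=
  ⟨(hπ.exists_lift (f ≫ eqToHom e.2.symm)).choose,
    (hπ.exists_lift (f ≫ eqToHom e.2.symm)).choose_spec.choose⟩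

theorem exists_pull_hom (hπ : IsExpansion π) {c d : C} (f : c ⟶ d)
    (e : {e : E // π.obj e = d}) :
    ∃ g : (hπ.pull f e).1 ⟶ e.1,
      π.map g = eqToHom (hπ.pull f e).2 ≫ f ≫ eqToHom e.2.symm :=
  (hπ.exists_lift (f ≫ eqToHom e.2.symm)).choose_spec.choose_spec

theorem pull_eq (hπ : IsExpansion π) {c d : C} (f : c ⟶ d) (e : {e : E // π.obj e = d})
    (e' : {e : E // π.obj e = c}) (g : e'.1 ⟶ e.1)
    (hg : π.map g = eqToHom e'.2 ≫ f ≫ eqToHom e.2.symm) : hπ.pull f e = e' := by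
  obtain ⟨k, hk⟩ := hπ.exists_pull_hom f e
  exact Subtype.ext (hπ.source_eq k g ((hπ.pull f e).2.trans e'.2.symm) (by simp [hk, hg]))

/-- The presheaf of fibers of an expansion. -/
noncomputable def fiberPresheaf (hπ : IsExpansion π) : Cᵒᵖ ⥤ Type u where
  obj c := {e : E // π.obj e = c.unop}
  map f := ↾(hπ.pull f.unop)
  map_id c := by
    ext e
    exact congrArg Subtype.val (hπ.pull_eq (𝟙 c.unop) e e (𝟙 _) (by simp))
  map_comp f f' := by
    ext e
    obtain ⟨k, hk⟩ := hπ.exists_pull_hom f.unop e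
    obtain ⟨k', hk'⟩ := hπ.exists_pull_hom f'.unop (hπ.pull f.unop e)
    exact congrArg Subtype.val (hπ.pull_eq (f'.unop ≫ f.unop) e
      (hπ.pull f'.unop (hπ.pull f.unop e)) (k' ≫ k) (by simp [hk, hk']))

/-- A global section of the presheaf of fibers gives a splitting of the expansion. -/
theorem exists_splitting (hπ : IsExpansion π) (s : hπ.fiberPresheaf.sections) :
    ∃ α : C ⥤ E, α ⋙ π = 𝟭 C := by
  have := hπ.faithful
  let t (c : C) : {e : E // π.obj e = c} := s.1 (op c)
  have hlift {c d : C} (f : c ⟶ d) : ∃ g : (t c).1 ⟶ (t d).1,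
      π.map g = eqToHom (t c).2 ≫ f ≫ eqToHom (t d).2.symm := by
    have hs : hπ.pull f (t d) = t c := s.2 f.op
    rw [← hs]
    exact hπ.exists_pull_hom f (t d)
  choose m hm using @hlift
  refine ⟨{ obj := fun c => (t c).1
            map := m
            map_id := fun c => π.map_injective (by simp [hm])
            map_comp := fun f g => π.map_injective (by simp [hm]) }, ?_⟩
  exact CategoryTheory.Functor.ext (fun c : C => (t c).2) fun c d f => by simp [hm]

end IsExpansion

section Elements

variable {C : Type u'} [Category.{v'} C] (F : Cᵒᵖ ⥤ Type u)

theorem isExpansion_elements (hF : ∀ c : C, Nonempty (F.obj (op c))) :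
    IsExpansion (CategoryOfElements.π F).leftOp where
  surj c := ⟨op ⟨op c, (hF c).some⟩, rfl⟩
  fib := by
    rintro ⟨⟨⟨d⟩, x⟩⟩ c f
    change c ⟶ d at f
    refine ⟨⟨op ⟨op c, F.map f.op x⟩, Quiver.Hom.op ⟨f.op, rfl⟩⟩, ⟨rfl, ?_⟩, ?_⟩
    · exact (Category.id_comp f).symm
    · rintro ⟨⟨⟨⟨c'⟩, y⟩⟩, g⟩ ⟨h, hg⟩
      change c' = c at h
      subst h
      obtain ⟨⟨g, hgy⟩, rfl⟩ : ∃ k, g = Quiver.Hom.op k := ⟨g.unop, rfl⟩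
      change op d ⟶ op c' at g
      change F.map (X := op d) (Y := op c') g x = y at hgy
      change g.unop = 𝟙 c' ≫ f at hg
      rw [Category.id_comp] at hg
      obtain rfl : g = f.op := by rw [← hg]; rfl
      subst hgy
      rfl

theorem precompact_elements (hF : ∀ c : C, Finite (F.obj (op c))) :
    Precompact (CategoryOfElements.π F).leftOp := by
  intro c
  have := hF c
  refine (Set.finite_range fun x : F.obj (op c) => (op ⟨op c, x⟩ : F.Elementsᵒᵖ)).subset ?_
  rintro ⟨⟨⟨d⟩, x⟩⟩ h
  change d = c at h
  subst h
  exact ⟨x, rfl⟩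

theorem map_transport {p q : F.Elements} (m : p ⟶ q) {d c : Cᵒᵖ} (hp : p.1 = d) (hq : q.1 = c)
    (f : d ⟶ c) (hm : m.1 = eqToHom hp ≫ f ≫ eqToHom hq.symm) :
    F.map f (F.map (eqToHom hp) p.2) = F.map (eqToHom hq) q.2 := by
  obtain ⟨d, x⟩ := p
  obtain ⟨c, y⟩ := q
  dsimp only at hp hq
  subst hp hq
  have hf : m.1 = f := hm.trans (by simp)
  have hx : F.map f x = y := hf ▸ m.2
  simpa using hx

theorem sections_nonempty_of_splitting (α : C ⥤ F.Elementsᵒᵖ)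
    (hα : α ⋙ (CategoryOfElements.π F).leftOp = 𝟭 C) : F.sections.Nonempty := by
  have hobj (c : C) : (α.obj c).unop.1 = op c :=
    congrArg op (Functor.congr_obj hα c)
  refine ⟨fun c => F.map (eqToHom (hobj c.unop)) (α.obj c.unop).unop.2, ?_⟩
  intro d c f
  refine map_transport F (α.map f.unop).unop (hobj d.unop) (hobj c.unop) f
    (Quiver.Hom.unop_inj ((Functor.congr_hom hα f.unop).trans ?_))
  simp only [Functor.id_map, unop_comp, eqToHom_unop, Category.assoc]
  rfl

end Elements

section Ramsey

variable {C : Type u} [Category.{v} C]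

theorem Confluent.exists_upper_bound (hC : Confluent C) (S : Finset C) (A : C) :
    ∃ B : C, Zigzag B A ∧ ∀ c ∈ S, Zigzag c A → Nonempty (c ⟶ B) := by
  classical
  induction S using Finset.induction_on with
  | empty => exact ⟨A, .refl A, by simp⟩
  | insert a S _ ih =>
    obtain ⟨B, hBA, hB⟩ := ih
    by_cases ha : Zigzag a A
    · obtain ⟨Z, i, j, -⟩ := hC a B (ha.trans hBA.symm)
      refine ⟨Z, (Zigzag.of_inv j).trans hBA, fun c hc hcA => ?_⟩
      rcases Finset.mem_insert.1 hc with rfl | hc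
      · exact ⟨i⟩
      · exact ⟨(hB c hc hcA).some ≫ j⟩
    · refine ⟨B, hBA, fun c hc hcA => ?_⟩
      rcases Finset.mem_insert.1 hc with rfl | hc
      · exact absurd hcA ha
      · exact hB c hc hcA

variable (F : Cᵒᵖ ⥤ Type)

/-- Under the Ramsey property some element of `F` over `B` has, for each of finitely many objects,
the same restriction along all arrows from that object. -/
theorem RamseyProp.exists_monochromatic (hC : RamseyProp C) (hfin : ∀ c, Finite (F.obj c))
    (hne : ∀ c, Nonempty (F.obj c)) (S : Finset C) (B : C) :
    ∃ x : F.obj (op B), ∀ c ∈ S, ∀ f f' : c ⟶ B, F.map f.op x = F.map f'.op x := by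
  classical
  induction S using Finset.induction_on generalizing B with
  | empty => exact ⟨(hne _).some, by simp⟩
  | insert a S _ ih =>
    obtain ⟨Z, hZ⟩ := hC a B (F.obj (op a)) (hfin _)
    obtain ⟨x, hx⟩ := ih Z
    obtain ⟨g, hg⟩ := hZ fun f => F.map f.op x
    refine ⟨F.map g.op x, fun c hc f f' => ?_⟩
    rcases Finset.mem_insert.1 hc with rfl | hc
    · simpa using hg f f'
    · simpa using hx c hc (f ≫ g) (f' ≫ g)

theorem exists_section_on_finset (hconf : Confluent C) (hram : RamseyProp C)
    (hfin : ∀ c, Finite (F.obj c)) (hne : ∀ c, Nonempty (F.obj c)) (S : Finset C) :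
    ∃ s : ∀ c : C, F.obj (op c),
      ∀ c ∈ S, ∀ d ∈ S, ∀ f : c ⟶ d, F.map f.op (s d) = s c := by
  classical
  choose B _ hB using fun k : ConnectedComponents C =>
    hconf.exists_upper_bound S (Quotient.out k)
  choose x hx using fun k => hram.exists_monochromatic F hfin hne S (B k)
  let comp (c : C) : ConnectedComponents C := Quotient.mk _ c
  let t (k : ConnectedComponents C) (c : C) : F.obj (op c) :=
    if h : Nonempty (c ⟶ B k) then F.map h.some.op (x k) else (hne _).some
  have ht {k c} (hc : c ∈ S) (i : c ⟶ B k) : t k c = F.map i.op (x k) := by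
    have h : Nonempty (c ⟶ B k) := ⟨i⟩
    simp only [t, dif_pos h]
    exact hx k c hc _ _
  refine ⟨fun c => t (comp c) c, fun c hc d hd f => ?_⟩
  have hcd : comp c = comp d := Quotient.sound (s := Zigzag.setoid C) (Zigzag.of_hom f)
  have hout : Zigzag d (Quotient.out (comp d)) :=
    Zigzag.symm (Quotient.mk_out (s := Zigzag.setoid C) d)
  obtain ⟨i⟩ := hB (comp d) d hd hout
  simp only [hcd]
  rw [ht hd i, ht hc (f ≫ i)]
  simp

theorem sections_nonempty_of_confluent_of_ramsey (hconf : Confluent C) (hram : RamseyProp C)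
    (hfin : ∀ c, Finite (F.obj c)) (hne : ∀ c, Nonempty (F.obj c)) : F.sections.Nonempty := by
  classical
  choose g hg using exists_section_on_finset F hconf hram hfin hne
  obtain ⟨s, hs⟩ := Finset.rado_selection g
  refine ⟨fun c => s c.unop, fun {d c} f => ?_⟩
  obtain ⟨T, hT, hsT⟩ := hs {c.unop, d.unop}
  dsimp only
  rw [hsT c.unop (by simp), hsT d.unop (by simp)]
  exact hg T _ (hT (by simp)) _ (hT (by simp)) f.unop

end Ramsey

section Counterexamples

variable {C : Type u} [Category.{v} C]

/-- The subpresheaf of the constant presheaf `Bool` which is `true` above `A` and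
`false` above `B`. -/
def separatingPresheaf (A B : C) : Cᵒᵖ ⥤ Type where
  obj c := {b : Bool // (Nonempty (A ⟶ c.unop) → b = true) ∧ (Nonempty (B ⟶ c.unop) → b = false)}
  map f := ↾fun b => ⟨b.1, fun ⟨i⟩ => b.2.1 ⟨i ≫ f.unop⟩, fun ⟨i⟩ => b.2.2 ⟨i ≫ f.unop⟩⟩

theorem nonempty_separatingPresheaf_obj {A B : C}
    (h : ¬ ∃ (Z : C) (_ : A ⟶ Z) (_ : B ⟶ Z), True) (c : C) :
    Nonempty ((separatingPresheaf A B).obj (op c)) := by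
  by_cases hA : Nonempty (A ⟶ c)
  · exact ⟨⟨true, fun _ => rfl, fun hB => (h ⟨c, hA.some, hB.some, trivial⟩).elim⟩⟩
  · exact ⟨⟨false, fun hA' => (hA hA').elim, fun _ => rfl⟩⟩

theorem not_zigzag_of_section {A B : C} (s : (separatingPresheaf A B).sections) :
    ¬ Zigzag A B := by
  intro hAB
  have hhom {c d : C} (f : c ⟶ d) : (s.1 (op d)).1 = (s.1 (op c)).1 :=
    congrArg Subtype.val (s.2 f.op)
  have hconst {c : C} (h : Zigzag A c) : (s.1 (op A)).1 = (s.1 (op c)).1 := by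
    induction h with
    | refl => rfl
    | tail _ hzag ih =>
      rcases hzag with ⟨⟨f⟩⟩ | ⟨⟨f⟩⟩
      · exact ih.trans (hhom f).symm
      · exact ih.trans (hhom f)
  have hval := hconst hAB
  rw [(s.1 (op A)).2.1 ⟨𝟙 A⟩, (s.1 (op B)).2.2 ⟨𝟙 B⟩] at hval
  exact Bool.noConfusion hval

/-- The presheaf of colorings of `Hom(A, -)` which no arrow from `B` makes monochromatic on
`Hom(A, B)`. -/
def badColorings (A B : C) (N : Type v) : Cᵒᵖ ⥤ Type v where
  obj Z := {χ : (A ⟶ Z.unop) → N //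
    ∀ g : B ⟶ Z.unop, ¬ ∀ f f' : A ⟶ B, χ (f ≫ g) = χ (f' ≫ g)}
  map h := ↾fun χ => ⟨fun f => χ.1 (f ≫ h.unop), fun g hg => χ.2 (g ≫ h.unop) (by simpa using hg)⟩

theorem isEmpty_badColorings_sections (A B : C) (N : Type v) :
    ¬ (badColorings A B N).sections.Nonempty := by
  rintro ⟨s, hs⟩
  have hconst (f : A ⟶ B) : (s (op B)).1 f = (s (op A)).1 (𝟙 A) := by
    rw [← hs f.op]
    exact congrArg (s (op B)).1 (Category.id_comp f).symm
  exact (s (op B)).2 (𝟙 B) fun f f' => by simp [hconst]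

end Counterexamples

theorem confluent_ramsey_iff_expansions_split (C : Type) [SmallCategory C]
    (hlf : ∀ A B : C, Finite (A ⟶ B)) :
    (Confluent C ∧ RamseyProp C) ↔
      ∀ (E : Type) (_ : SmallCategory E) (π : E ⥤ C),
        IsExpansion π → Precompact π → ∃ α : C ⥤ E, α ⋙ π = 𝟭 C := by
  constructor
  · rintro ⟨hconf, hram⟩ E _ π hπ hfin
    obtain ⟨s, hs⟩ := sections_nonempty_of_confluent_of_ramsey hπ.fiberPresheaf hconf hram
      (fun c => (hfin c.unop).to_subtype)
      (fun c => ⟨⟨_, (hπ.surj c.unop).choose_spec⟩⟩)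
    exact hπ.exists_splitting ⟨s, hs⟩
  · intro H
    have hsec (F : Cᵒᵖ ⥤ Type) (hfin : ∀ c, Finite (F.obj (op c)))
        (hne : ∀ c, Nonempty (F.obj (op c))) : F.sections.Nonempty := by
      obtain ⟨α, hα⟩ := H F.Elementsᵒᵖ inferInstance _ (isExpansion_elements F hne)
        (precompact_elements F hfin)
      exact sections_nonempty_of_splitting F α hα
    constructor
    · intro A B hAB
      by_contra h
      obtain ⟨s, hs⟩ := hsec (separatingPresheaf A B)
        (fun c => by dsimp only [separatingPresheaf]; infer_instance)
        (nonempty_separatingPresheaf_obj h)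
      exact not_zigzag_of_section ⟨s, hs⟩ hAB
    · intro A B N _
      by_contra! h
      refine isEmpty_badColorings_sections A B N (hsec _ (fun c => ?_) fun c => ?_)
      · have := hlf A c
        dsimp only [badColorings]
        infer_instance
      · obtain ⟨χ, hχ⟩ := h c
        exact ⟨⟨χ, fun g hg => by obtain ⟨f, f', hne⟩ := hχ g; exact hne (hg f f')⟩⟩
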